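/- (Soundness of the SYNC rule) Fix a binary relation R on State, a recursion variable X, a valuation V, chop formulas Ψ, Ψ' ∈ CF_{(R,X)}, and trace sets A, D ⊆ State⁺. If L(gr(Ψ')) ⊆ L(gr(Ψ)) and A ⊆ ⟦μX.Ψ'⟧_V ∪ D, then A ⊆ ⟦μX.Ψ⟧_V ∪ D. -/

import Mathlib

/-- A trace is a nonempty finite list of states (an element of `State⁺`). -/
abbrev Trace (State : Type) : Type := {l : List State // l ≠ []}

/-- Trace formulas: `Φ ::= p | R | Φ∧Φ | Φ∨Φ | Φ⌢Φ | X | μX.Φ`. -/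
inductive TF (State RVar : Type) : Type where
  | pred : (State → Prop) → TF State RVar
  | rel  : (State → State → Prop) → TF State RVar
  | conj : TF State RVar → TF State RVar → TF State RVar
  | disj : TF State RVar → TF State RVar → TF State RVar
  | chop : TF State RVar → TF State RVar → TF State RVar
  | var  : RVar → TF State RVar
  | mu   : RVar → TF State RVar → TF State RVar

/-- Chop of trace sets: `A ⋈ B = {σ·s·σ' | σ·s ∈ A ∧ s·σ' ∈ B}`,
the two parts overlapping in the single shared state `s`. -/
def chopSet {State : Type} (A B : Set (Trace State)) : Set (Trace State) :=
  {t | ∃ (σ σ' : List State) (s : State),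
    t.1 = σ ++ s :: σ' ∧
    (⟨σ ++ [s], by simp⟩ : Trace State) ∈ A ∧
    (⟨s :: σ', by simp⟩ : Trace State) ∈ B}

/-- Semantics of trace formulas under a valuation `V : RVar → 𝒫(State⁺)`. -/
def sem {State RVar : Type} [DecidableEq RVar] :
    TF State RVar → (RVar → Set (Trace State)) → Set (Trace State)
  | TF.pred p, _ => {t | ∃ (s : State) (σ : List State), t.1 = s :: σ ∧ p s}
  | TF.rel R, _ => {t | ∃ s s', t.1 = [s, s'] ∧ R s s'}
  | TF.conj a b, V => sem a V ∩ sem b V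
  | TF.disj a b, V => sem a V ∪ sem b V
  | TF.chop a b, V => chopSet (sem a V) (sem b V)
  | TF.var X, V => V X
  | TF.mu X a, V => ⋂₀ {γ : Set (Trace State) | sem a (Function.update V X γ) ⊆ γ}

/-- Atoms of primitive chop formulas over a fixed relation `R`
and recursion variable `X`: either `R` or `X`. A primitive chop formula
`S₁⌢…⌢S_k` is a (nonempty) list of atoms; since `grammatize` sends it to
the word `S₁S₂⋯S_k` over terminal `R` and nonterminal `X`, words of the
grammar are lists of atoms as well. -/
inductive Atom : Type where
  | r : Atom
  | x : Atom
deriving DecidableEq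

/-- The trace formula denoted by an atom. -/
def Atom.toTF {State RVar : Type} (R : State → State → Prop) (X : RVar) :
    Atom → TF State RVar
  | Atom.r => TF.rel R
  | Atom.x => TF.var X

/-- The trace formula `S₁⌢…⌢S_k` denoted by a primitive chop formula
(the empty list is mapped to a junk formula with empty semantics). -/
def pcfToTF {State RVar : Type} (R : State → State → Prop) (X : RVar) :
    List Atom → TF State RVar
  | [] => TF.pred fun _ => False
  | [a] => a.toTF R X
  | a :: b :: rest => TF.chop (a.toTF R X) (pcfToTF R X (b :: rest))

/-- The trace formula `⋁_{1≤j≤n} φ_j` denoted by a chop formula, i.e. by a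
finite disjunction of primitive chop formulas. -/
def cfToTF {State RVar : Type} (R : State → State → Prop) (X : RVar) :
    List (List Atom) → TF State RVar
  | [] => TF.pred fun _ => False
  | [c] => pcfToTF R X c
  | c :: d :: rest => TF.disj (pcfToTF R X c) (cfToTF R X (d :: rest))

/-- `SubstX S φ ψ`: `ψ` is obtained from `φ` by replacing each occurrence of
the atom `X` by some (possibly different) element of `S`. -/
inductive SubstX (S : Set (List Atom)) : List Atom → List Atom → Prop where
  | nil : SubstX S [] []
  | r {φ ψ : List Atom} : SubstX S φ ψ → SubstX S (Atom.r :: φ) (Atom.r :: ψ)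
  | x {φ ψ : List Atom} (c : List Atom) :
      c ∈ S → SubstX S φ ψ → SubstX S (Atom.x :: φ) (c ++ ψ)

/-- Derivability of sentential forms in the grammar `gr(Ψ)` with single
nonterminal `X`, single terminal `R`, initial nonterminal `X`, and one
production `X → S₁⋯S_k` for each disjunct `S₁⌢…⌢S_k` of `Ψ`. -/
inductive Derives (Ψ : List (List Atom)) : List Atom → Prop where
  | start : Derives Ψ [Atom.x]
  | step {u v c : List Atom} :
      c ∈ Ψ → Derives Ψ (u ++ Atom.x :: v) → Derives Ψ (u ++ c ++ v)

/-- `L(gr(Ψ)) ⊆ {R}*`: the terminal words derivable from `X` in `gr(Ψ)`. -/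
def Lang (Ψ : List (List Atom)) : Set (List Atom) :=
  {w | Derives Ψ w ∧ Atom.x ∉ w}

theorem chop_assoc {State : Type} (A B C : Set (Trace State)) :
    chopSet (chopSet A B) C = chopSet A (chopSet B C) := by
  ext ⟨t, ht⟩
  constructor
  · rintro ⟨p, q, s, h1, ⟨a, b, r, h2, hA, hB⟩, hC⟩
    simp only at h1 h2
    rcases List.eq_nil_or_concat b with rfl | ⟨b', z, rfl⟩
    · obtain ⟨rfl, h3⟩ := List.append_inj' h2 rfl
      obtain rfl : s = r := by simpa using h3
      exact ⟨p, q, s, h1, hA, [], q, s, rfl, hB, hC⟩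
    · have h2' : p ++ [s] = (a ++ r :: b') ++ [z] := by simpa using h2
      obtain ⟨rfl, h3⟩ := List.append_inj' h2' rfl
      obtain rfl : s = z := by simpa using h3
      refine ⟨a, b' ++ s :: q, r, by simpa using h1, hA, r :: b', q, s, by simp, ?_, hC⟩
      simpa using hB
  · rintro ⟨p, q, s, h1, hA, ⟨a, b, r, h2, hB, hC⟩⟩
    simp only at h1 h2
    cases a with
    | nil =>
      obtain ⟨rfl, rfl⟩ : s = r ∧ q = b := by simpa using h2
      exact ⟨p, q, s, h1, ⟨p, [], s, rfl, hA, hB⟩, hC⟩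
    | cons z a =>
      obtain ⟨rfl, rfl⟩ : s = z ∧ q = a ++ r :: b := by simpa using h2
      exact ⟨p ++ s :: a, b, r, by simpa using h1, ⟨p, a ++ [r], s, by simp, hA, hB⟩, hC⟩

theorem chop_mono {State : Type} {A A' B B' : Set (Trace State)} (hA : A ⊆ A') (hB : B ⊆ B') :
    chopSet A B ⊆ chopSet A' B' := by
  rintro t ⟨p, q, s, h1, h2, h3⟩
  exact ⟨p, q, s, h1, hA h2, hB h3⟩

/-- The set of one-state traces, the unit of chop. -/
def unitSet (State : Type) : Set (Trace State) := {t | ∃ s, t.1 = [s]}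

theorem unit_chop {State : Type} (A : Set (Trace State)) : chopSet (unitSet State) A = A := by
  ext ⟨t, ht⟩
  constructor
  · rintro ⟨p, q, s, h1, ⟨r, h2⟩, h3⟩
    have hp : p = [] := by
      have := congrArg List.length h2
      simpa using this
    subst hp
    simp only [List.nil_append] at h1
    subst h1
    exact h3
  · intro h
    cases t with
    | nil => exact absurd rfl ht
    | cons s q => exact ⟨[], q, s, rfl, ⟨s, rfl⟩, h⟩

theorem chop_unit {State : Type} (A : Set (Trace State)) : chopSet A (unitSet State) = A := by
  ext ⟨t, ht⟩
  constructor
  · rintro ⟨p, q, s, h1, h3, ⟨r, h2⟩⟩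
    have hp : q = [] := by
      have := congrArg List.length h2
      simpa using this
    subst hp
    simp only at h1
    subst h1
    exact h3
  · intro h
    rcases List.eq_nil_or_concat t with rfl | ⟨p, s, rfl⟩
    · exact absurd rfl ht
    · exact ⟨p, [], s, by simp, by simpa using h, ⟨s, rfl⟩⟩

/-- Atom semantics. -/
def atomSem {State : Type} (R : State → State → Prop) (γ : Set (Trace State)) :
    Atom → Set (Trace State)
  | Atom.r => {t | ∃ s s', t.1 = [s, s'] ∧ R s s'}
  | Atom.x => γ

/-- Semantics of words of atoms. -/
def wordSem {State : Type} (R : State → State → Prop) (γ : Set (Trace State)) :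
    List Atom → Set (Trace State)
  | [] => unitSet State
  | a :: w => chopSet (atomSem R γ a) (wordSem R γ w)

theorem wordSem_append {State : Type} (R : State → State → Prop) (γ : Set (Trace State))
    (u v : List Atom) : wordSem R γ (u ++ v) = chopSet (wordSem R γ u) (wordSem R γ v) := by
  induction u with
  | nil => simp [wordSem, unit_chop]
  | cons a u ih => simp [wordSem, ih, chop_assoc]

theorem wordSem_mono {State : Type} (R : State → State → Prop) {γ δ : Set (Trace State)}
    (h : γ ⊆ δ) (w : List Atom) : wordSem R γ w ⊆ wordSem R δ w := by
  induction w with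
  | nil => exact subset_rfl
  | cons a w ih =>
    refine chop_mono ?_ ih
    cases a
    · exact subset_rfl
    · exact h

theorem sem_atom {State RVar : Type} [DecidableEq RVar] (R : State → State → Prop) (X : RVar)
    (V : RVar → Set (Trace State)) (γ : Set (Trace State)) (a : Atom) :
    sem (a.toTF R X) (Function.update V X γ) = atomSem R γ a := by
  cases a <;> simp [Atom.toTF, sem, atomSem]

theorem sem_pcf {State RVar : Type} [DecidableEq RVar] (R : State → State → Prop) (X : RVar)
    (V : RVar → Set (Trace State)) (γ : Set (Trace State)) (c : List Atom) (hc : c ≠ []) :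
    sem (pcfToTF R X c) (Function.update V X γ) = wordSem R γ c := by
  induction c with
  | nil => exact absurd rfl hc
  | cons a c ih =>
    cases c with
    | nil => simp [pcfToTF, wordSem, sem_atom, chop_unit]
    | cons b c =>
      have := ih (by simp)
      rw [pcfToTF, sem, this, sem_atom]; rfl

theorem sem_cf {State RVar : Type} [DecidableEq RVar] (R : State → State → Prop) (X : RVar)
    (V : RVar → Set (Trace State)) (γ : Set (Trace State)) (Ψ : List (List Atom))
    (h : ∀ c ∈ Ψ, c ≠ []) (t : Trace State) :
    t ∈ sem (cfToTF R X Ψ) (Function.update V X γ) ↔ ∃ c ∈ Ψ, t ∈ wordSem R γ c := by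
  induction Ψ with
  | nil => simp [cfToTF, sem]
  | cons c Ψ ih =>
    cases Ψ with
    | nil => simp [cfToTF, sem_pcf R X V γ c (h c (by simp))]
    | cons d Ψ =>
      have := ih (fun c hc => h c (List.mem_cons_of_mem _ hc))
      rw [cfToTF, sem, Set.mem_union, this, sem_pcf R X V γ c (h c (by simp)),
        List.exists_mem_cons_iff (a := c)]

theorem derives_subst {Ψ : List (List Atom)} {u v w : List Atom}
    (h : Derives Ψ (u ++ Atom.x :: v)) (hw : Derives Ψ w) : Derives Ψ (u ++ w ++ v) := by
  induction hw with
  | start => simpa using h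
  | @step a b c hc _ ih =>
    have := Derives.step (u := u ++ a) (v := b ++ v) hc (by simpa using ih)
    simpa using this

theorem lang_expand {State : Type} (R : State → State → Prop) (Ψ : List (List Atom))
    (c : List Atom) : ∀ (u v : List Atom) (t : Trace State), Derives Ψ (u ++ c ++ v) →
      t ∈ wordSem R {t | ∃ w ∈ Lang Ψ, t ∈ wordSem R ∅ w} c →
      ∃ w, Atom.x ∉ w ∧ Derives Ψ (u ++ w ++ v) ∧ t ∈ wordSem R ∅ w := by
  induction c with
  | nil => exact fun u v t h ht => ⟨[], by simp, h, ht⟩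
  | cons a c ih =>
    rintro u v t h ⟨p, q, s, h1, h2, h3⟩
    cases a with
    | r =>
      obtain ⟨w, hx, hd, hw⟩ := ih (u ++ [Atom.r]) v _ (by simpa using h) h3
      exact ⟨Atom.r :: w, by simpa using hx, by simpa using hd, p, q, s, h1, h2, hw⟩
    | x =>
      obtain ⟨w1, ⟨hd1, hx1⟩, hw1⟩ := h2
      have h' := derives_subst (u := u) (v := c ++ v) (by simpa using h) hd1
      obtain ⟨w, hx, hd, hw⟩ := ih (u ++ w1) v _ (by simpa using h') h3
      refine ⟨w1 ++ w, by simp [hx, hx1], by simpa using hd, ?_⟩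
      rw [wordSem_append]
      exact ⟨p, q, s, h1, hw1, hw⟩

theorem derives_sound {State : Type} (R : State → State → Prop) (Ψ : List (List Atom))
    (γ : Set (Trace State)) (hγ : ∀ c ∈ Ψ, wordSem R γ c ⊆ γ) {w : List Atom}
    (hw : Derives Ψ w) : wordSem R γ w ⊆ γ := by
  induction hw with
  | start => simp [wordSem, chop_unit, atomSem]
  | @step u v c hc _ ih =>
    refine subset_trans ?_ ih
    rw [List.append_assoc, wordSem_append, wordSem_append, wordSem_append]
    exact chop_mono subset_rfl (chop_mono (hγ c hc) subset_rfl)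

/-- Soundness of the SYNC rule: if `L(gr(Ψ')) ⊆ L(gr(Ψ))`
and `A ⊆ ⟦μX.Ψ'⟧_V ∪ D`, then `A ⊆ ⟦μX.Ψ⟧_V ∪ D`. -/
theorem sync_rule_sound {State RVar : Type} [DecidableEq RVar]
    (R : State → State → Prop) (X : RVar) (V : RVar → Set (Trace State))
    (Ψ Ψ' : List (List Atom))
    (hΨ : Ψ ≠ []) (hpcf : ∀ c ∈ Ψ, c ≠ [])
    (hΨ' : Ψ' ≠ []) (hpcf' : ∀ c ∈ Ψ', c ≠ [])
    (A D : Set (Trace State))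
    (hlang : Lang Ψ' ⊆ Lang Ψ)
    (hA : A ⊆ sem (TF.mu X (cfToTF R X Ψ')) V ∪ D) :
    A ⊆ sem (TF.mu X (cfToTF R X Ψ)) V ∪ D := by
  intro t ht
  rcases hA ht with h | h
  · left
    have h1 : t ∈ {t | ∃ w ∈ Lang Ψ', t ∈ wordSem R ∅ w} := by
      rw [sem] at h
      refine h _ ?_
      intro t' ht'
      obtain ⟨c, hc, hct⟩ := (sem_cf R X V _ Ψ' hpcf' t').1 ht'
      obtain ⟨w, hx, hd, hw⟩ := lang_expand R Ψ' c [] [] t'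
        (Derives.step (u := []) (v := []) hc Derives.start) hct
      exact ⟨w, ⟨by simpa using hd, hx⟩, hw⟩
    obtain ⟨w, hwL, hw⟩ := h1
    rw [sem]
    intro γ hγ
    refine derives_sound R Ψ γ ?_ (hlang hwL).1 (wordSem_mono R (Set.empty_subset γ) w hw)
    intro c hc t' ht'
    exact hγ ((sem_cf R X V γ Ψ hpcf t').2 ⟨c, hc, ht'⟩)
  · exact Or.inr h
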